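/- arXiv:1304.4813 — 2 statements merged into one kernel-verified Lean document; each statement's English description precedes it below -/
import Mathlib

section
/- For all integers n ≥ k ≥ 1 one has the identity (in ℚ): Σ_{π ∈ Π_n^k} emb(π) = (k(k−1)/4)·S_{n,k} − ((k−1)/2)·S_{n,k−1} + (n/2)·S_{n−1,k−2}. Equivalently, the average number of embracings in a random set partition of [n] into k blocks equals this quantity divided by S_{n,k}. -/
open scoped Classical

def seg (n : ℕ) : Finset ℕ := Finset.Icc 1 n

def IsPartition (P : Finset (Finset ℕ)) (S : Finset ℕ) : Prop :=
  ∅ ∉ P ∧ (∀ B ∈ P, ∀ C ∈ P, B ≠ C → Disjoint B C) ∧ P.biUnion id = S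

noncomputable def partitions (n : ℕ) : Finset (Finset (Finset ℕ)) :=
  ((seg n).powerset.powerset).filter fun P => IsPartition P (seg n)

noncomputable def partitionsK (n k : ℕ) : Finset (Finset (Finset ℕ)) :=
  (partitions n).filter fun P => P.card = k

noncomputable def bell (n : ℕ) : ℕ := (partitions n).card

noncomputable def stirling (n k : ℕ) : ℕ := (partitionsK n k).card

/-- `(i, j)` is an edge of the set partition `P`. -/
def IsEdge (P : Finset (Finset ℕ)) (i j : ℕ) : Prop :=
  i < j ∧ ∃ B ∈ P, i ∈ B ∧ j ∈ B ∧ ∀ p ∈ B, ¬(i < p ∧ p < j)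

/-- `crol P`: number of linear crossings. -/
noncomputable def crol (P : Finset (Finset ℕ)) : ℕ :=
  Nat.card {e : (ℕ × ℕ) × ℕ × ℕ //
    IsEdge P e.1.1 e.1.2 ∧ IsEdge P e.2.1 e.2.2 ∧
      e.1.1 < e.2.1 ∧ e.2.1 < e.1.2 ∧ e.1.2 < e.2.2}

/-- `(i, j)` is a circular edge of `P`. -/
def IsCircEdge (P : Finset (Finset ℕ)) (i j : ℕ) : Prop :=
  IsEdge P i j ∨
    ∃ B ∈ P, ∃ h : B.Nonempty, 2 ≤ B.card ∧ i = B.min' h ∧ j = B.max' h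

/-- `croc P`: number of circular crossings. -/
noncomputable def croc (P : Finset (Finset ℕ)) : ℕ :=
  Nat.card {e : (ℕ × ℕ) × ℕ × ℕ //
    IsCircEdge P e.1.1 e.1.2 ∧ IsCircEdge P e.2.1 e.2.2 ∧
      e.1.1 < e.2.1 ∧ e.2.1 < e.1.2 ∧ e.1.2 < e.2.2}

/-- Two blocks overlap: `min B < min B' < max B < max B'`. -/
def Overlap (B B' : Finset ℕ) : Prop :=
  ∃ (h : B.Nonempty) (h' : B'.Nonempty),
    B.min' h < B'.min' h' ∧ B'.min' h' < B.max' h ∧ B.max' h < B'.max' h'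

/-- `ov P`: number of (unordered) pairs of blocks of `P` that overlap. -/
noncomputable def ov (P : Finset (Finset ℕ)) : ℕ :=
  Nat.card {p : Finset ℕ × Finset ℕ // p.1 ∈ P ∧ p.2 ∈ P ∧ Overlap p.1 p.2}

/-- Two blocks embrace: `min B < min B' ≤ max B' < max B`. -/
def Embrace (B B' : Finset ℕ) : Prop :=
  ∃ (h : B.Nonempty) (h' : B'.Nonempty),
    B.min' h < B'.min' h' ∧ B'.min' h' ≤ B'.max' h' ∧ B'.max' h' < B.max' h

noncomputable def emb (P : Finset (Finset ℕ)) : ℕ :=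
  Nat.card {p : Finset ℕ × Finset ℕ // p.1 ∈ P ∧ p.2 ∈ P ∧ Embrace p.1 p.2}

/-- The block of `P` containing `i`. -/
noncomputable def blockOf (P : Finset (Finset ℕ)) (i : ℕ) : Finset ℕ :=
  (P.filter fun B => i ∈ B).biUnion id

/-- The restricted growth function of `P`: `rgf P i = j` iff `i` lies in the `j`-th
block of `P`, the blocks being ordered by increasing minima. -/
noncomputable def rgf (P : Finset (Finset ℕ)) (i : ℕ) : ℕ :=
  (P.filter fun B => B.min ≤ (blockOf P i).min).card

/-- A 2-pattern: a word on `{1,2}` containing both letters. -/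
def TwoPattern {r : ℕ} (σ : Fin r → ℕ) : Prop :=
  (∀ t, σ t = 1 ∨ σ t = 2) ∧ (∃ t, σ t = 1) ∧ (∃ t, σ t = 2)

/-- `occ n σ P`: number of occurrences of the 2-pattern `σ` in the partition `P` of `[n]`. -/
noncomputable def occ (n : ℕ) {r : ℕ} (σ : Fin r → ℕ) (P : Finset (Finset ℕ)) : ℕ :=
  Nat.card {i : Fin r → ℕ // StrictMono i ∧ (∀ t, i t ∈ seg n) ∧
    ∃ a b : ℕ, a < b ∧
      ∀ t, (σ t = 1 → rgf P (i t) = a) ∧ (σ t = 2 → rgf P (i t) = b)}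

/-- Carlitz `q`-Stirling polynomials. -/
noncomputable def qS : ℕ → ℕ → Polynomial ℚ
  | 0, 0 => 1
  | 0, _ + 1 => 0
  | _ + 1, 0 => 0
  | n + 1, k + 1 =>
      Polynomial.X ^ k * qS n k +
        (∑ i ∈ Finset.range (k + 1), Polynomial.X ^ i) * qS n (k + 1)

/-- Standardization: the order preserving bijection `S → [|S|]`. -/
def stdMap (S : Finset ℕ) (a : ℕ) : ℕ := (S.filter fun x => x ≤ a).card

/-- The standardized 2-block partition obtained from two blocks `A, B`. -/
def stdPair (A B : Finset ℕ) : Finset (Finset ℕ) :=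
  {A.image (stdMap (A ∪ B)), B.image (stdMap (A ∪ B))}

/-- `B` starts before `C`: both blocks are nonempty and `min B < min C`. -/
def MinLT (B C : Finset ℕ) : Prop :=
  ∃ (h : B.Nonempty) (h' : C.Nonempty), B.min' h < C.min' h'

/-- Ordered pairs of disjoint nonempty sets with union `S`. -/
def splits (S : Finset ℕ) : Finset (Finset ℕ × Finset ℕ) :=
  (S.powerset ×ˢ S.powerset).filter fun p =>
    p.1.Nonempty ∧ p.2.Nonempty ∧ Disjoint p.1 p.2 ∧ p.1 ∪ p.2 = S

theorem mem_splits {S : Finset ℕ} {p : Finset ℕ × Finset ℕ} :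
    p ∈ splits S ↔ p.1.Nonempty ∧ p.2.Nonempty ∧ Disjoint p.1 p.2 ∧ p.1 ∪ p.2 = S := by
  simp only [splits, Finset.mem_filter, Finset.mem_product, Finset.mem_powerset,
    and_iff_right_iff_imp]
  rintro ⟨-, -, -, rfl⟩
  exact ⟨Finset.subset_union_left, Finset.subset_union_right⟩

theorem IsPartition.nonempty {P : Finset (Finset ℕ)} {T B : Finset ℕ} (h : IsPartition P T)
    (hB : B ∈ P) : B.Nonempty :=
  Finset.nonempty_iff_ne_empty.2 fun h0 => h.1 (h0 ▸ hB)

theorem IsPartition.subset {P : Finset (Finset ℕ)} {T B : Finset ℕ} (h : IsPartition P T)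
    (hB : B ∈ P) : B ⊆ T :=
  h.2.2 ▸ Finset.subset_biUnion_of_mem id hB

theorem isPartition_insert {P : Finset (Finset ℕ)} {T B : Finset ℕ} (hB : B ∉ P) :
    IsPartition (insert B P) T ↔ B.Nonempty ∧ B ⊆ T ∧ IsPartition P (T \ B) := by
  constructor
  · intro h
    have hd : ∀ C ∈ P, Disjoint B C := fun C hC =>
      h.2.1 B (Finset.mem_insert_self _ _) C (Finset.mem_insert_of_mem hC)
        fun e => hB (e ▸ hC)
    refine ⟨h.nonempty (Finset.mem_insert_self _ _), h.subset (Finset.mem_insert_self _ _),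
      fun h0 => h.1 (Finset.mem_insert_of_mem h0), fun C hC D hD => h.2.1 C
        (Finset.mem_insert_of_mem hC) D (Finset.mem_insert_of_mem hD), ?_⟩
    rw [← h.2.2, Finset.biUnion_insert, id, Finset.union_sdiff_left, eq_comm,
      Finset.sdiff_eq_self_iff_disjoint, Finset.disjoint_biUnion_left]
    exact fun C hC => (hd C hC).symm
  · rintro ⟨hne, hsub, h⟩
    have hd : ∀ C ∈ P, Disjoint B C := fun C hC =>
      (Finset.disjoint_of_subset_left (h.subset hC) Finset.sdiff_disjoint).symm
    refine ⟨?_, ?_, ?_⟩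
    · rw [Finset.mem_insert, not_or]
      exact ⟨hne.ne_empty.symm, h.1⟩
    · intro C hC D hD hCD
      rcases Finset.mem_insert.1 hC with rfl | hC' <;>
        rcases Finset.mem_insert.1 hD with rfl | hD'
      · exact absurd rfl hCD
      · exact hd D hD'
      · exact (hd C hC').symm
      · exact h.2.1 C hC' D hD' hCD
    · rw [Finset.biUnion_insert, h.2.2, id, Finset.union_sdiff_of_subset hsub]

theorem IsPartition.notMem_of_sdiff {P : Finset (Finset ℕ)} {T B : Finset ℕ} (hne : B.Nonempty)
    (h : IsPartition P (T \ B)) : B ∉ P := fun hB =>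
  hne.ne_empty (Finset.disjoint_self_iff_empty _ |>.1
    (Finset.disjoint_of_subset_left (h.subset hB) Finset.sdiff_disjoint))

theorem isPartition_erase {P : Finset (Finset ℕ)} {T B : Finset ℕ} (hB : B ∈ P)
    (h : IsPartition P T) : IsPartition (P.erase B) (T \ B) := by
  rw [← Finset.insert_erase hB, isPartition_insert (Finset.notMem_erase B P)] at h
  exact h.2.2

theorem mem_partitionsK {n k : ℕ} {P : Finset (Finset ℕ)} :
    P ∈ partitionsK n k ↔ IsPartition P (seg n) ∧ P.card = k := by
  simp only [partitionsK, partitions, Finset.mem_filter, Finset.mem_powerset, and_congr_left_iff,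
    and_iff_right_iff_imp]
  exact fun _ h B hB => Finset.mem_powerset.2 (h.subset hB)

/-- Merging two blocks: marked pairs of blocks in partitions with `j + 1` blocks correspond to
splittings of a marked block in partitions with `j` blocks. -/
theorem sum_card_pairs_eq_sum_splits (n j : ℕ) (g : Finset ℕ × Finset ℕ → Prop)
    (hg : ∀ p, g p → p.1 ≠ p.2) :
    ∑ P ∈ partitionsK n (j + 1), ((P ×ˢ P).filter g).card =
      ∑ Q ∈ partitionsK n j, ∑ S ∈ Q, ((splits S).filter g).card := by
  rw [← Finset.card_sigma, Finset.sum_sigma', ← Finset.card_sigma]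
  refine Finset.card_nbij'
    (fun x => ⟨⟨insert (x.2.1 ∪ x.2.2) ((x.1.erase x.2.1).erase x.2.2), x.2.1 ∪ x.2.2⟩, x.2⟩)
    (fun y => ⟨insert y.2.1 (insert y.2.2 (y.1.1.erase y.1.2)), y.2⟩) ?_ ?_ ?_ ?_
  · rintro ⟨P, B, C⟩ hx
    simp only [Finset.coe_sigma, Set.mem_sigma_iff, Finset.mem_coe, mem_partitionsK,
      Finset.mem_filter, Finset.mem_product, mem_splits] at hx ⊢
    obtain ⟨⟨hP, hc⟩, ⟨hB, hC⟩, hgp⟩ := hx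
    have hBC : B ≠ C := hg _ hgp
    have hC' : C ∈ P.erase B := Finset.mem_erase.2 ⟨hBC.symm, hC⟩
    have hR := isPartition_erase hC' (isPartition_erase hB hP)
    rw [sdiff_sdiff_left, Finset.sup_eq_union] at hR
    have hne : (B ∪ C).Nonempty := (hP.nonempty hB).mono Finset.subset_union_left
    have hnm := hR.notMem_of_sdiff hne
    refine ⟨⟨⟨(isPartition_insert hnm).2
      ⟨hne, Finset.union_subset (hP.subset hB) (hP.subset hC), hR⟩, ?_⟩,
      Finset.mem_insert_self _ _⟩, ⟨hP.nonempty hB, hP.nonempty hC, hP.2.1 B hB C hC hBC, trivial⟩,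
      hgp⟩
    have h1 := Finset.card_erase_add_one hB
    have h2 := Finset.card_erase_add_one hC'
    rw [Finset.card_insert_of_notMem hnm]
    omega
  · rintro ⟨⟨Q, S⟩, B, C⟩ hy
    simp only [Finset.coe_sigma, Set.mem_sigma_iff, Finset.mem_coe, mem_partitionsK,
      Finset.mem_filter, Finset.mem_product, mem_splits] at hy ⊢
    obtain ⟨⟨⟨hQ, hc⟩, hS⟩, ⟨hB, hC, hd, rfl⟩, hgp⟩ := hy
    have hR := isPartition_erase hS hQ
    have hsub := hQ.subset hS
    rw [← Finset.sup_eq_union, ← sdiff_sdiff_left] at hR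
    have hCm := hR.notMem_of_sdiff hC
    have hP := (isPartition_insert hCm).2 ⟨hC, Finset.subset_sdiff.2
      ⟨Finset.subset_union_right.trans hsub, hd.symm⟩, hR⟩
    have hBm := hP.notMem_of_sdiff hB
    refine ⟨⟨(isPartition_insert hBm).2 ⟨hB, Finset.subset_union_left.trans hsub, hP⟩, ?_⟩,
      ⟨Finset.mem_insert_self _ _, Finset.mem_insert_of_mem (Finset.mem_insert_self _ _)⟩, hgp⟩
    have h1 := Finset.card_erase_add_one hS
    simp only [Finset.sup_eq_union] at hBm hCm
    rw [Finset.card_insert_of_notMem hBm, Finset.card_insert_of_notMem hCm]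
    omega
  · rintro ⟨P, B, C⟩ hx
    simp only [Finset.coe_sigma, Set.mem_sigma_iff, Finset.mem_coe, mem_partitionsK,
      Finset.mem_filter, Finset.mem_product] at hx
    obtain ⟨⟨hP, hc⟩, ⟨hB, hC⟩, hgp⟩ := hx
    have hBC : B ≠ C := hg _ hgp
    have hC' : C ∈ P.erase B := Finset.mem_erase.2 ⟨hBC.symm, hC⟩
    have hR := isPartition_erase hC' (isPartition_erase hB hP)
    rw [sdiff_sdiff_left, Finset.sup_eq_union] at hR
    have hnm := hR.notMem_of_sdiff ((hP.nonempty hB).mono Finset.subset_union_left)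
    simp only [Finset.erase_insert hnm, Finset.insert_erase hC', Finset.insert_erase hB]
  · rintro ⟨⟨Q, S⟩, B, C⟩ hy
    simp only [Finset.coe_sigma, Set.mem_sigma_iff, Finset.mem_coe, mem_partitionsK,
      Finset.mem_filter, mem_splits] at hy
    obtain ⟨⟨⟨hQ, hc⟩, hS⟩, ⟨hB, hC, hd, rfl⟩, hgp⟩ := hy
    have hR := isPartition_erase hS hQ
    have hsub := hQ.subset hS
    rw [← Finset.sup_eq_union, ← sdiff_sdiff_left] at hR
    have hCm := hR.notMem_of_sdiff hC
    have hP := (isPartition_insert hCm).2 ⟨hC, Finset.subset_sdiff.2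
      ⟨Finset.subset_union_right.trans hsub, hd.symm⟩, hR⟩
    have hBm := hP.notMem_of_sdiff hB
    simp only [Finset.sup_eq_union] at hBm hCm
    simp only [Finset.erase_insert hBm, Finset.erase_insert hCm, Finset.insert_erase hS]

theorem emb_eq_card_filter (P : Finset (Finset ℕ)) :
    emb P = ((P ×ˢ P).filter fun p => Embrace p.1 p.2).card := by
  refine Nat.subtype_card _ fun p => ?_
  simp only [Finset.mem_filter, Finset.mem_product, and_assoc]

theorem IsPartition.min'_ne {P : Finset (Finset ℕ)} {T B C : Finset ℕ} (h : IsPartition P T)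
    (hB : B ∈ P) (hC : C ∈ P) (hBC : B ≠ C) :
    B.min' (h.nonempty hB) ≠ C.min' (h.nonempty hC) := fun e =>
  Finset.disjoint_left.1 (h.2.1 B hB C hC hBC) (Finset.min'_mem B _)
    (e ▸ Finset.min'_mem C _)

theorem IsPartition.two_mul_card_minLT {P : Finset (Finset ℕ)} {T : Finset ℕ}
    (h : IsPartition P T) :
    2 * ((P ×ˢ P).filter fun p => MinLT p.1 p.2).card = P.card * P.card - P.card := by
  have hswap : ((P ×ˢ P).filter fun p => MinLT p.1 p.2).card =
      ((P ×ˢ P).filter fun p => MinLT p.2 p.1).card :=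
    Finset.card_equiv (Equiv.prodComm _ _) fun p => by
      simp [and_comm]
  have hdisj : Disjoint ((P ×ˢ P).filter fun p => MinLT p.1 p.2)
      ((P ×ˢ P).filter fun p => MinLT p.2 p.1) :=
    Finset.disjoint_filter.2 fun p _ ⟨_, _, h1⟩ ⟨_, _, h2⟩ => lt_asymm h1 h2
  rw [← Finset.offDiag_card, two_mul]
  nth_rewrite 2 [hswap]
  rw [← Finset.card_union_of_disjoint hdisj]
  congr 1
  ext ⟨B, C⟩
  simp only [Finset.mem_union, Finset.mem_filter, Finset.mem_product, Finset.mem_offDiag]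
  constructor
  · rintro (⟨⟨hB, hC⟩, _, _, hlt⟩ | ⟨⟨hB, hC⟩, _, _, hlt⟩) <;>
    · refine ⟨hB, hC, ?_⟩
      rintro rfl
      exact lt_irrefl _ hlt
  · rintro ⟨hB, hC, hBC⟩
    rcases lt_or_gt_of_ne (h.min'_ne hB hC hBC) with hlt | hlt
    · exact Or.inl ⟨⟨hB, hC⟩, _, _, hlt⟩
    · exact Or.inr ⟨⟨hB, hC⟩, _, _, hlt⟩

theorem minLT_iff_min'_notMem {S B C : Finset ℕ} (hS : S.Nonempty) (h : (B, C) ∈ splits S) :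
    MinLT B C ↔ S.min' hS ∉ C := by
  obtain ⟨hB, hC, hd, rfl⟩ := mem_splits.1 h
  dsimp only at hB hC hd
  constructor
  · rintro ⟨_, _, hlt⟩ hmem
    exact absurd hlt (not_lt.2 ((Finset.min'_le _ _ hmem).trans
      (Finset.min'_le _ _ (Finset.mem_union_left _ (Finset.min'_mem B hB)))))
  · intro hmem
    have hmB := (Finset.mem_union.1 (Finset.min'_mem _ hS)).resolve_right hmem
    refine ⟨hB, hC, (Finset.min'_le _ _ hmB).trans_lt (lt_of_le_of_ne
      (Finset.min'_le _ _ (Finset.mem_union_right _ (Finset.min'_mem C hC))) fun e => hmem ?_)⟩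
    exact e ▸ Finset.min'_mem C hC

theorem embrace_iff_notMem {S B C : Finset ℕ} (hS : S.Nonempty) (h : (B, C) ∈ splits S) :
    Embrace B C ↔ S.max' hS ∉ C ∧ S.min' hS ∉ C := by
  rw [← minLT_iff_min'_notMem hS h]
  obtain ⟨hB, hC, hd, rfl⟩ := mem_splits.1 h
  dsimp only at hB hC hd
  constructor
  · rintro ⟨_, _, hlt, -, hlt'⟩
    refine ⟨fun hmem => ?_, _, _, hlt⟩
    exact absurd hlt' (not_lt.2 ((Finset.le_max' _ _ (Finset.mem_union_left _
      (Finset.max'_mem B hB))).trans (Finset.le_max' _ _ hmem)))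
  · rintro ⟨hmem, _, _, hlt⟩
    have hmB := (Finset.mem_union.1 (Finset.max'_mem _ hS)).resolve_right hmem
    refine ⟨hB, hC, hlt, Finset.min'_le_max' _ _, (lt_of_le_of_ne
      (Finset.le_max' _ _ (Finset.mem_union_right _ (Finset.max'_mem C hC)))
        fun e => hmem ?_).trans_le (Finset.le_max' _ _ hmB)⟩
    exact e ▸ Finset.max'_mem C hC

/-- Splittings of `S` whose second part avoids a subset `A` containing some element of `S`. -/
theorem card_splits_filter {S A : Finset ℕ} {g : Finset ℕ × Finset ℕ → Prop}
    (hA : (S ∩ A).Nonempty) (hg : ∀ p ∈ splits S, g p ↔ Disjoint p.2 A) :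
    ((splits S).filter g).card + 1 = 2 ^ (S \ A).card := by
  have himage : (splits S).filter g =
      ((S \ A).powerset.erase ∅).image fun C => (S \ C, C) := by
    ext ⟨B, C⟩
    simp only [Finset.mem_filter, Finset.mem_image, Finset.mem_erase, Finset.mem_powerset,
      Prod.mk.injEq, exists_eq_right_right, Finset.subset_sdiff]
    constructor
    · rintro ⟨hs, hgp⟩
      obtain ⟨hB, hC, hd, rfl⟩ := mem_splits.1 hs
      exact ⟨⟨hC.ne_empty, Finset.subset_union_right, (hg _ hs).1 hgp⟩,
        Finset.union_sdiff_cancel_right hd⟩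
    · rintro ⟨⟨hC, hCS, hCA⟩, rfl⟩
      obtain ⟨a, ha⟩ := hA
      rw [Finset.mem_inter] at ha
      have hs : (S \ C, C) ∈ splits S := mem_splits.2
        ⟨⟨a, Finset.mem_sdiff.2 ⟨ha.1, fun h => Finset.disjoint_left.1 hCA h ha.2⟩⟩,
          Finset.nonempty_iff_ne_empty.2 hC, Finset.sdiff_disjoint,
          Finset.sdiff_union_of_subset hCS⟩
      exact ⟨hs, (hg _ hs).2 hCA⟩
  rw [himage, Finset.card_image_of_injective _ fun C D h => (Prod.mk.inj h).2,
    Finset.card_erase_add_one (Finset.empty_mem_powerset _), Finset.card_powerset]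

theorem two_mul_card_embrace_splits {S : Finset ℕ} (hS : S.Nonempty) :
    2 * ((splits S).filter fun p => Embrace p.1 p.2).card + 1 =
      ((splits S).filter fun p => MinLT p.1 p.2).card + if S.card = 1 then 1 else 0 := by
  have h1 := card_splits_filter (S := S) (A := {S.min' hS}) (g := fun p => MinLT p.1 p.2)
    ⟨S.min' hS, by simp [Finset.min'_mem]⟩
    fun p hp => by rw [minLT_iff_min'_notMem hS hp, Finset.disjoint_singleton_right]
  have h2 := card_splits_filter (S := S) (A := {S.max' hS, S.min' hS})
    (g := fun p => Embrace p.1 p.2) ⟨S.min' hS, by simp [Finset.min'_mem]⟩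
    fun p hp => by
      rw [embrace_iff_notMem hS hp, Finset.disjoint_insert_right, Finset.disjoint_singleton_right]
  rw [Finset.card_sdiff_of_subset (by simp [Finset.min'_mem])] at h1
  rw [Finset.card_sdiff_of_subset
    (by simp [Finset.insert_subset_iff, Finset.min'_mem, Finset.max'_mem])] at h2
  have hpos := hS.card_pos
  split_ifs with hc
  · rw [hc] at h1 h2
    simp only [Finset.card_singleton, Nat.sub_self, pow_zero] at h1
    have : 1 - ({S.max' hS, S.min' hS} : Finset ℕ).card = 0 := by
      have : 0 < ({S.max' hS, S.min' hS} : Finset ℕ).card := Finset.card_pos.2 (Finset.insert_nonempty _ _)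
      omega
    rw [this, pow_zero] at h2
    omega
  · have hlt := Finset.min'_lt_max'_of_card S (by omega)
    rw [Finset.card_pair hlt.ne'] at h2
    rw [Finset.card_singleton, show S.card - 1 = S.card - 2 + 1 by omega, pow_succ] at h1
    omega

theorem isPartition_image_equiv (σ : Equiv.Perm ℕ) {P : Finset (Finset ℕ)} {T : Finset ℕ}
    (h : IsPartition P T) : IsPartition (σ.finsetCongr.finsetCongr P) (σ.finsetCongr T) := by
  refine ⟨?_, ?_, ?_⟩
  · simpa [Equiv.finsetCongr_apply] using h.1
  · simp only [Equiv.finsetCongr_apply, Finset.mem_map, Equiv.coe_toEmbedding]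
    rintro _ ⟨B, hB, rfl⟩ _ ⟨C, hC, rfl⟩ hBC
    exact (Finset.disjoint_map _).2 (h.2.1 B hB C hC fun e => hBC (e ▸ rfl))
  · rw [← h.2.2]
    simp only [Equiv.finsetCongr_apply, Finset.map_eq_image, Finset.image_biUnion,
      Finset.biUnion_image, id, Equiv.coe_toEmbedding]

theorem card_filter_singleton_mem_eq {n k i j : ℕ} (hi : i ∈ seg n) (hj : j ∈ seg n) :
    ((partitionsK n k).filter fun Q => {i} ∈ Q).card =
      ((partitionsK n k).filter fun Q => {j} ∈ Q).card := by
  have key : ∀ i j, i ∈ seg n → j ∈ seg n → ∀ Q ∈ (partitionsK n k).filter fun Q => {i} ∈ Q,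
      (Equiv.swap i j).finsetCongr.finsetCongr Q ∈
        (partitionsK n k).filter fun Q => {j} ∈ Q := by
    intro i j hi hj Q hQ
    simp only [Finset.mem_filter, mem_partitionsK] at hQ ⊢
    obtain ⟨⟨hQ, hc⟩, hiQ⟩ := hQ
    have hT : (Equiv.swap i j).finsetCongr (seg n) = seg n := by
      refine Finset.eq_of_subset_of_card_le ?_ (by simp [Equiv.finsetCongr_apply])
      intro x hx
      simp only [Equiv.finsetCongr_apply, Finset.mem_map, Equiv.coe_toEmbedding] at hx
      obtain ⟨y, hy, rfl⟩ := hx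
      rw [Equiv.swap_apply_def]
      split_ifs <;> assumption
    refine ⟨⟨hT ▸ isPartition_image_equiv _ hQ, by simpa [Equiv.finsetCongr_apply] using hc⟩, ?_⟩
    simp only [Equiv.finsetCongr_apply, Finset.mem_map, Equiv.coe_toEmbedding]
    exact ⟨{i}, hiQ, by simp⟩
  apply le_antisymm
  · exact Finset.card_le_card_of_injOn _ (key i j hi hj) (Equiv.injective _).injOn
  · exact Finset.card_le_card_of_injOn _ (key j i hj hi) (Equiv.injective _).injOn

theorem card_filter_last_singleton_mem (m k : ℕ) :
    ((partitionsK (m + 1) (k + 1)).filter fun Q => {m + 1} ∈ Q).card = stirling m k := by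
  have hseg : seg (m + 1) \ {m + 1} = seg m := by
    ext x
    simp only [seg, Finset.mem_sdiff, Finset.mem_Icc, Finset.mem_singleton]
    omega
  have hm : m + 1 ∈ seg (m + 1) := by simp [seg]
  refine Finset.card_nbij' (fun Q => Q.erase {m + 1}) (fun R => insert {m + 1} R) ?_ ?_ ?_ ?_
  · intro Q hQ
    simp only [Finset.coe_filter, Set.mem_ofPred_eq, Finset.mem_coe, mem_partitionsK] at hQ ⊢
    refine ⟨hseg ▸ isPartition_erase hQ.2 hQ.1.1, ?_⟩
    rw [Finset.card_erase_of_mem hQ.2, hQ.1.2, Nat.add_sub_cancel]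
  · intro R hR
    simp only [Finset.coe_filter, Set.mem_ofPred_eq, Finset.mem_coe, mem_partitionsK] at hR ⊢
    rw [← hseg] at hR
    have hnm := hR.1.notMem_of_sdiff (Finset.singleton_nonempty _)
    refine ⟨⟨(isPartition_insert hnm).2 ⟨Finset.singleton_nonempty _,
      Finset.singleton_subset_iff.2 hm, hR.1⟩, ?_⟩, Finset.mem_insert_self _ _⟩
    rw [Finset.card_insert_of_notMem hnm, hR.2]
  · intro Q hQ
    exact Finset.insert_erase (Finset.mem_filter.1 hQ).2
  · intro R hR
    have hR := (mem_partitionsK.1 hR).1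
    rw [← hseg] at hR
    exact Finset.erase_insert (hR.notMem_of_sdiff (Finset.singleton_nonempty _))

/-- The total number of singleton blocks. -/
theorem sum_card_singleton_blocks (m k : ℕ) :
    ∑ Q ∈ partitionsK (m + 1) (k + 1), (Q.filter fun S => S.card = 1).card =
      (m + 1) * stirling m k := by
  have h : ∀ Q ∈ partitionsK (m + 1) (k + 1), (Q.filter fun S => S.card = 1).card =
      ((seg (m + 1)).filter fun i => {i} ∈ Q).card := by
    intro Q hQ
    rw [← Finset.card_image_of_injective ((seg (m + 1)).filter fun i => {i} ∈ Q)
      Finset.singleton_injective]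
    congr 1
    ext S
    simp only [Finset.mem_filter, Finset.mem_image, Finset.card_eq_one]
    constructor
    · rintro ⟨hS, i, rfl⟩
      exact ⟨i, ⟨Finset.singleton_subset_iff.1 ((mem_partitionsK.1 hQ).1.subset hS), hS⟩, rfl⟩
    · rintro ⟨i, ⟨-, hi⟩, rfl⟩
      exact ⟨hi, i, rfl⟩
  rw [Finset.sum_congr rfl h]
  simp only [Finset.card_filter]
  rw [Finset.sum_comm]
  simp only [← Finset.card_filter]
  rw [Finset.sum_congr rfl fun i hi => (card_filter_singleton_mem_eq hi
    (show m + 1 ∈ seg (m + 1) by simp [seg])).trans (card_filter_last_singleton_mem m k),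
    Finset.sum_const, smul_eq_mul]
  simp [seg]

theorem two_mul_sum_emb (n j : ℕ) :
    2 * ∑ π ∈ partitionsK n (j + 1), emb π + j * stirling n j =
      ∑ π ∈ partitionsK n (j + 1), ((π ×ˢ π).filter fun p => MinLT p.1 p.2).card +
        ∑ Q ∈ partitionsK n j, (Q.filter fun S => S.card = 1).card := by
  simp only [emb_eq_card_filter]
  rw [sum_card_pairs_eq_sum_splits, sum_card_pairs_eq_sum_splits]
  · have hj : j * stirling n j = ∑ Q ∈ partitionsK n j, ∑ S ∈ Q, 1 := by
      rw [Finset.sum_congr rfl fun Q hQ => (Finset.card_eq_sum_ones Q).symm.trans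
        (mem_partitionsK.1 hQ).2, Finset.sum_const, smul_eq_mul, mul_comm, stirling]
    simp only [hj, Finset.card_filter _ (_ : Finset (Finset ℕ)), Finset.mul_sum,
      ← Finset.sum_add_distrib]
    exact Finset.sum_congr rfl fun Q hQ => Finset.sum_congr rfl fun S hS => by
      simpa only [Finset.card_filter, Finset.mul_sum] using
        two_mul_card_embrace_splits ((mem_partitionsK.1 hQ).1.nonempty hS)
  · rintro ⟨B, C⟩ ⟨_, _, hlt⟩ (rfl : B = C)
    exact lt_irrefl _ hlt
  · rintro ⟨B, C⟩ ⟨_, _, hlt, -⟩ (rfl : B = C)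
    exact lt_irrefl _ hlt

theorem two_mul_sum_card_minLT (n j : ℕ) :
    2 * ∑ π ∈ partitionsK n (j + 1), ((π ×ˢ π).filter fun p => MinLT p.1 p.2).card =
      (j + 1) * j * stirling n (j + 1) := by
  rw [Finset.mul_sum, Finset.sum_congr rfl fun π hπ =>
    (mem_partitionsK.1 hπ).1.two_mul_card_minLT.trans
      (congrArg (fun c => c * c - c) (mem_partitionsK.1 hπ).2), Finset.sum_const, smul_eq_mul,
    mul_comm, stirling, ← Nat.mul_sub_one, Nat.add_sub_cancel]

/-- exact total and average number of embracings over `Π_n^k`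
(with the convention `S_{n,k} = 0` for `k < 0`). -/
theorem emb_mean_over_partitionsK (n k : ℕ) (hk : 1 ≤ k) (hkn : k ≤ n) :
    (∑ π ∈ partitionsK n k, (emb π : ℚ))
        = ((k : ℚ) * ((k : ℚ) - 1) / 4) * (stirling n k : ℚ)
            - (((k : ℚ) - 1) / 2) * (stirling n (k-1) : ℚ)
            + ((n : ℚ)/2) * (if 2 ≤ k then (stirling (n-1) (k-2) : ℚ) else 0) ∧
    (∑ π ∈ partitionsK n k, (emb π : ℚ)) / (stirling n k : ℚ)
        = (((k : ℚ) * ((k : ℚ) - 1) / 4) * (stirling n k : ℚ)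
            - (((k : ℚ) - 1) / 2) * (stirling n (k-1) : ℚ)
            + ((n : ℚ)/2) * (if 2 ≤ k then (stirling (n-1) (k-2) : ℚ) else 0))
          / (stirling n k : ℚ) := by
  suffices h : (∑ π ∈ partitionsK n k, (emb π : ℚ))
      = ((k : ℚ) * ((k : ℚ) - 1) / 4) * (stirling n k : ℚ)
          - (((k : ℚ) - 1) / 2) * (stirling n (k-1) : ℚ)
          + ((n : ℚ)/2) * (if 2 ≤ k then (stirling (n-1) (k-2) : ℚ) else 0) from
    ⟨h, by rw [h]⟩
  obtain ⟨j, rfl⟩ : ∃ j, k = j + 1 := ⟨k - 1, by omega⟩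
  obtain ⟨m, rfl⟩ : ∃ m, n = m + 1 := ⟨n - 1, by omega⟩
  have h1 := two_mul_sum_emb (m + 1) j
  have h2 := two_mul_sum_card_minLT (m + 1) j
  have h3 : ((∑ Q ∈ partitionsK (m + 1) j, (Q.filter fun S => S.card = 1).card : ℕ) : ℚ) =
      (m + 1) * if 2 ≤ j + 1 then (stirling m (j + 1 - 2) : ℚ) else 0 := by
    rcases j with _ | i
    · rw [Finset.sum_eq_zero]
      · simp
      · intro Q hQ
        rw [Finset.card_eq_zero.1 (mem_partitionsK.1 hQ).2]
        simp
    · rw [sum_card_singleton_blocks, if_pos (by omega)]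
      push_cast
      rfl
  have h1' := congrArg (Nat.cast : ℕ → ℚ) h1
  have h2' := congrArg (Nat.cast : ℕ → ℚ) h2
  rw [Nat.cast_add _ (∑ Q ∈ partitionsK (m + 1) j, _), h3] at h1'
  push_cast at h1' h2' ⊢
  linarith
end

section
/- Let σ and τ be two 2-patterns of the same length r whose first letters coincide (σ₁ = τ₁). Then for all integers n ≥ 1 and k ≥ 1, Σ_{π ∈ Π_n^k} occ_σ(π) = Σ_{π ∈ Π_n^k} occ_τ(π), and consequently Σ_{π ∈ Π_n} occ_σ(π) = Σ_{π ∈ Π_n} occ_τ(π). In other words, the average number of occurrences of a 2-pattern of length r in a random set partition of [n] (into k blocks) depends only on the first letter of the pattern. -/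
open scoped Classical

namespace IsPartition

variable {P : Finset (Finset ℕ)} {S : Finset ℕ}

theorem eq_of_mem (h : IsPartition P S) {A B : Finset ℕ} {x : ℕ} (hA : A ∈ P) (hB : B ∈ P)
    (hxA : x ∈ A) (hxB : x ∈ B) : A = B := by
  by_contra hne
  exact Finset.disjoint_left.1 (h.2.1 A hA B hB hne) hxA hxB

theorem exists_mem (h : IsPartition P S) {x : ℕ} (hx : x ∈ S) : ∃ A ∈ P, x ∈ A := by
  rw [← h.2.2] at hx
  simpa using hx

theorem blockOf_eq (h : IsPartition P S) {A : Finset ℕ} {x : ℕ} (hA : A ∈ P) (hx : x ∈ A) :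
    blockOf P x = A := by
  have : (P.filter fun B => x ∈ B) = {A} := by
    ext B
    simp only [Finset.mem_filter, Finset.mem_singleton]
    exact ⟨fun hB => h.eq_of_mem hB.1 hA hB.2 hx, by rintro rfl; exact ⟨hA, hx⟩⟩
  simp [blockOf, this]

theorem eq_of_min_eq (h : IsPartition P S) {A B : Finset ℕ} (hA : A ∈ P) (hB : B ∈ P)
    (hmin : A.min = B.min) : A = B := by
  obtain ⟨m, hm⟩ := Finset.min_of_nonempty
    (Finset.nonempty_iff_ne_empty.2 fun hA' => h.1 (hA' ▸ hA))
  exact h.eq_of_mem hA hB (Finset.mem_of_min hm) (Finset.mem_of_min (hmin ▸ hm))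

theorem rgf_lt_rgf_of_min_lt (h : IsPartition P S) {A B : Finset ℕ} {x y : ℕ} (hA : A ∈ P)
    (hB : B ∈ P) (hx : x ∈ A) (hy : y ∈ B) (hmin : A.min < B.min) : rgf P x < rgf P y := by
  rw [rgf, rgf, h.blockOf_eq hA hx, h.blockOf_eq hB hy]
  refine Finset.card_lt_card (Finset.ssubset_iff_of_subset ?_ |>.2 ⟨B, ?_, ?_⟩)
  · exact Finset.monotone_filter_right _ fun C _ hC => hC.trans hmin.le
  · exact Finset.mem_filter.2 ⟨hB, le_rfl⟩
  · exact fun hmem => (Finset.mem_filter.1 hmem).2.not_gt hmin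

theorem rgf_eq_rgf_iff (h : IsPartition P S) {A B : Finset ℕ} {x y : ℕ} (hA : A ∈ P)
    (hB : B ∈ P) (hx : x ∈ A) (hy : y ∈ B) : rgf P x = rgf P y ↔ A = B := by
  refine ⟨fun heq => ?_, ?_⟩
  · rcases lt_trichotomy A.min B.min with hlt | hmin | hlt
    · exact absurd heq (h.rgf_lt_rgf_of_min_lt hA hB hx hy hlt).ne
    · exact h.eq_of_min_eq hA hB hmin
    · exact absurd heq (h.rgf_lt_rgf_of_min_lt hB hA hy hx hlt).ne'
  · rintro rfl
    rw [rgf, rgf, h.blockOf_eq hA hx, h.blockOf_eq hA hy]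

theorem rgf_lt_rgf_iff (h : IsPartition P S) {A B : Finset ℕ} {x y : ℕ} (hA : A ∈ P)
    (hB : B ∈ P) (hx : x ∈ A) (hy : y ∈ B) : rgf P x < rgf P y ↔ A.min < B.min := by
  refine ⟨fun hlt => ?_, h.rgf_lt_rgf_of_min_lt hA hB hx hy⟩
  rcases lt_trichotomy A.min B.min with hmin | hmin | hmin
  · exact hmin
  · exact absurd ((h.rgf_eq_rgf_iff hA hB hx hy).2 (h.eq_of_min_eq hA hB hmin)) hlt.ne
  · exact absurd (h.rgf_lt_rgf_of_min_lt hB hA hy hx hmin) hlt.asymm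

end IsPartition

/-- `A` starts before `B`: some element of `A` is smaller than every element of `B`. -/
def Precedes (A B : Finset ℕ) : Prop := ∃ x ∈ A, ∀ y ∈ B, x < y

theorem min_lt_min_iff_precedes {A B : Finset ℕ} : A.min < B.min ↔ Precedes A B := by
  constructor
  · intro h
    obtain ⟨m, hm⟩ := Finset.min_of_nonempty (s := A) (by
      rw [Finset.nonempty_iff_ne_empty]
      rintro rfl
      simp at h)
    refine ⟨m, Finset.mem_of_min hm, fun y hy => ?_⟩
    have := h.trans_le (Finset.min_le hy)
    rw [hm] at this
    exact_mod_cast this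
  · rintro ⟨x, hx, hlt⟩
    rcases B.eq_empty_or_nonempty with rfl | hB
    · exact (Finset.min_le hx).trans_lt (by simp)
    · obtain ⟨m, hm⟩ := Finset.min_of_nonempty hB
      rw [hm]
      refine (Finset.min_le hx).trans_lt ?_
      exact_mod_cast hlt m (Finset.mem_of_min hm)

/-- Some two blocks of `P`, the first preceding the second, contain `S₁` and `S₂`. -/
def HasBlocks (S₁ S₂ : Finset ℕ) (P : Finset (Finset ℕ)) : Prop :=
  ∃ A ∈ P, ∃ B ∈ P, Precedes A B ∧ S₁ ⊆ A ∧ S₂ ⊆ B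

/-- The values of `i` at the positions where `σ` has the letter `l`. -/
def letterSet {r : ℕ} (σ : Fin r → ℕ) (i : Fin r → ℕ) (l : ℕ) : Finset ℕ :=
  (Finset.univ.filter fun t => σ t = l).image i

theorem mem_letterSet {r : ℕ} {σ i : Fin r → ℕ} {l x : ℕ} :
    x ∈ letterSet σ i l ↔ ∃ t, σ t = l ∧ i t = x := by
  simp [letterSet]

theorem exists_rgf_iff_hasBlocks {n r : ℕ} {σ : Fin r → ℕ} (hσ : TwoPattern σ)
    {P : Finset (Finset ℕ)} (hP : IsPartition P (seg n)) {i : Fin r → ℕ}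
    (hi : ∀ t, i t ∈ seg n) :
    (∃ a b : ℕ, a < b ∧ ∀ t, (σ t = 1 → rgf P (i t) = a) ∧ (σ t = 2 → rgf P (i t) = b)) ↔
      HasBlocks (letterSet σ i 1) (letterSet σ i 2) P := by
  obtain ⟨-, ⟨t₁, h₁⟩, ⟨t₂, h₂⟩⟩ := hσ
  constructor
  · rintro ⟨a, b, hab, h⟩
    obtain ⟨A, hA, hxA⟩ := hP.exists_mem (hi t₁)
    obtain ⟨B, hB, hxB⟩ := hP.exists_mem (hi t₂)
    have ha := (h t₁).1 h₁
    have hb := (h t₂).2 h₂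
    refine ⟨A, hA, B, hB, ?_, ?_, ?_⟩
    · rw [← min_lt_min_iff_precedes, ← hP.rgf_lt_rgf_iff hA hB hxA hxB]
      omega
    all_goals
      intro x hx
      obtain ⟨t, ht, rfl⟩ := mem_letterSet.1 hx
      obtain ⟨C, hC, hxC⟩ := hP.exists_mem (hi t)
    · rwa [(hP.rgf_eq_rgf_iff hA hC hxA hxC).1 (ha.trans ((h t).1 ht).symm)]
    · rwa [(hP.rgf_eq_rgf_iff hB hC hxB hxC).1 (hb.trans ((h t).2 ht).symm)]
  · rintro ⟨A, hA, B, hB, hAB, hS₁, hS₂⟩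
    have m₁ : ∀ t, σ t = 1 → i t ∈ A := fun t ht => hS₁ (mem_letterSet.2 ⟨t, ht, rfl⟩)
    have m₂ : ∀ t, σ t = 2 → i t ∈ B := fun t ht => hS₂ (mem_letterSet.2 ⟨t, ht, rfl⟩)
    refine ⟨rgf P (i t₁), rgf P (i t₂), ?_, fun t => ⟨fun ht => ?_, fun ht => ?_⟩⟩
    · exact (hP.rgf_lt_rgf_iff hA hB (m₁ _ h₁) (m₂ _ h₂)).2 (min_lt_min_iff_precedes.2 hAB)
    · exact (hP.rgf_eq_rgf_iff hA hA (m₁ _ ht) (m₁ _ h₁)).2 rfl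
    · exact (hP.rgf_eq_rgf_iff hB hB (m₂ _ ht) (m₂ _ h₂)).2 rfl

/-- Adjoin to `q.1` the two blocks `q.2.1 ∪ S₁` and `q.2.2 ∪ S₂`. -/
def glue (S₁ S₂ : Finset ℕ) (q : Finset (Finset ℕ) × Finset ℕ × Finset ℕ) :
    Finset (Finset ℕ) :=
  insert (q.2.1 ∪ S₁) (insert (q.2.2 ∪ S₂) q.1)

/-- The blocks of `q.1` together with `q.2.1`, `q.2.2` and `X` are pairwise disjoint with
union `S`; of these sets only `q.2.1`, `q.2.2` and `X` may be empty. -/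
def IsFrame (X S : Finset ℕ) (q : Finset (Finset ℕ) × Finset ℕ × Finset ℕ) : Prop :=
  IsPartition q.1 (S \ (q.2.1 ∪ q.2.2 ∪ X)) ∧ q.2.1 ∪ q.2.2 ∪ X ⊆ S ∧
    Disjoint q.2.1 q.2.2 ∧ Disjoint q.2.1 X ∧ Disjoint q.2.2 X

section Frame

variable {S₁ S₂ S : Finset ℕ} {q : Finset (Finset ℕ) × Finset ℕ × Finset ℕ}

theorem IsFrame.disjoint_left (h : IsFrame (S₁ ∪ S₂) S q) {C : Finset ℕ} (hC : C ∈ q.1) :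
    Disjoint C (q.2.1 ∪ q.2.2 ∪ (S₁ ∪ S₂)) := by
  have : C ⊆ S \ (q.2.1 ∪ q.2.2 ∪ (S₁ ∪ S₂)) := by
    rw [← h.1.2.2]
    exact Finset.subset_biUnion_of_mem id hC
  exact Finset.disjoint_of_subset_left this Finset.sdiff_disjoint

theorem IsFrame.union_left_notMem (h : IsFrame (S₁ ∪ S₂) S q) (hd : Disjoint S₁ S₂)
    (h₁ : S₁.Nonempty) : q.2.1 ∪ S₁ ∉ insert (q.2.2 ∪ S₂) q.1 := by
  obtain ⟨x, hx⟩ := h₁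
  obtain ⟨-, -, -, -, h5⟩ := id h
  intro hmem
  rcases Finset.mem_insert.1 hmem with heq | hmem
  · have : x ∈ q.2.2 ∪ S₂ := heq ▸ Finset.mem_union_right _ hx
    rw [Finset.disjoint_left] at hd h5
    grind
  · have := Finset.disjoint_left.1 (h.disjoint_left hmem) (Finset.mem_union_right _ hx)
    grind

theorem IsFrame.union_right_notMem (h : IsFrame (S₁ ∪ S₂) S q) (h₂ : S₂.Nonempty) :
    q.2.2 ∪ S₂ ∉ q.1 := by
  obtain ⟨x, hx⟩ := h₂
  intro hmem
  have := Finset.disjoint_left.1 (h.disjoint_left hmem) (Finset.mem_union_right _ hx)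
  grind

theorem IsFrame.card_glue (h : IsFrame (S₁ ∪ S₂) S q) (hd : Disjoint S₁ S₂)
    (h₁ : S₁.Nonempty) (h₂ : S₂.Nonempty) : (glue S₁ S₂ q).card = q.1.card + 2 := by
  rw [glue, Finset.card_insert_of_notMem (h.union_left_notMem hd h₁),
    Finset.card_insert_of_notMem (h.union_right_notMem h₂)]

theorem IsFrame.isPartition_glue (h : IsFrame (S₁ ∪ S₂) S q) (hd : Disjoint S₁ S₂)
    (h₁ : S₁.Nonempty) (h₂ : S₂.Nonempty) : IsPartition (glue S₁ S₂ q) S := by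
  have hQ := fun C hC => h.disjoint_left (C := C) hC
  obtain ⟨⟨hne, hpd, hun⟩, hsub, hAB, hAX, hBX⟩ := h
  have hAB' : Disjoint (q.2.1 ∪ S₁) (q.2.2 ∪ S₂) := by
    simp only [Finset.disjoint_union_left, Finset.disjoint_union_right] at *
    exact ⟨⟨hAB, hBX.1.symm⟩, hAX.2, hd⟩
  have hQA : ∀ C ∈ q.1, Disjoint C (q.2.1 ∪ S₁) := fun C hC =>
    Finset.disjoint_of_subset_right (by grind) (hQ C hC)
  have hQB : ∀ C ∈ q.1, Disjoint C (q.2.2 ∪ S₂) := fun C hC =>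
    Finset.disjoint_of_subset_right (by grind) (hQ C hC)
  refine ⟨?_, ?_, ?_⟩
  · have e₁ := (h₁.mono (Finset.subset_union_right (s₁ := q.2.1))).ne_empty
    have e₂ := (h₂.mono (Finset.subset_union_right (s₁ := q.2.2))).ne_empty
    simp only [glue, Finset.mem_insert, not_or]
    exact ⟨e₁.symm, e₂.symm, hne⟩
  · intro B hB C hC hBC
    simp only [glue, Finset.mem_insert] at hB hC
    rcases hB with rfl | rfl | hB <;> rcases hC with rfl | rfl | hC
    · exact absurd rfl hBC
    · exact hAB'
    · exact (hQA C hC).symm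
    · exact hAB'.symm
    · exact absurd rfl hBC
    · exact (hQB C hC).symm
    · exact hQA B hB
    · exact hQB B hB
    · exact hpd B hB C hC hBC
  · rw [glue, Finset.biUnion_insert, Finset.biUnion_insert, hun]
    ext x
    have := @hsub x
    simp only [id, Finset.mem_union, Finset.mem_sdiff] at *
    tauto

theorem injOn_glue (hd : Disjoint S₁ S₂) (h₁ : S₁.Nonempty) (h₂ : S₂.Nonempty) :
    Set.InjOn (glue S₁ S₂) {q | IsFrame (S₁ ∪ S₂) S q} := by
  intro q hq q' hq' heq
  have hP := IsFrame.isPartition_glue hq hd h₁ h₂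
  have key : ∀ {A A' T : Finset ℕ}, T.Nonempty → A ∪ T ∈ glue S₁ S₂ q →
      A' ∪ T ∈ glue S₁ S₂ q → Disjoint A T → Disjoint A' T → A = A' := by
    rintro A A' T ⟨x, hx⟩ hA hA' hT hT'
    have := hP.eq_of_mem hA hA' (Finset.mem_union_right _ hx) (Finset.mem_union_right _ hx)
    rw [← Finset.union_sdiff_cancel_right hT, this, Finset.union_sdiff_cancel_right hT']
  obtain ⟨-, -, -, hAX, hBX⟩ := id hq
  obtain ⟨-, -, -, hAX', hBX'⟩ := id hq'
  rw [Finset.disjoint_union_right] at hAX hBX hAX' hBX'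
  have eA : q.2.1 = q'.2.1 :=
    key h₁ (by simp [glue]) (by rw [heq]; simp [glue]) hAX.1 hAX'.1
  have eB : q.2.2 = q'.2.2 :=
    key h₂ (by simp [glue]) (by rw [heq]; simp [glue]) hBX.2 hBX'.2
  have eQ : q.1 = q'.1 := by
    have n₁ := IsFrame.union_left_notMem hq hd h₁
    have n₁' := IsFrame.union_left_notMem hq' hd h₁
    have n₂ := IsFrame.union_right_notMem hq h₂
    have n₂' := IsFrame.union_right_notMem hq' h₂
    rw [glue, glue, ← eA, ← eB] at heq
    rw [← eA, ← eB] at n₁'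
    rw [← eB] at n₂'
    rw [← Finset.erase_insert n₂, ← Finset.erase_insert n₁, heq, Finset.erase_insert n₁',
      Finset.erase_insert n₂']
  exact Prod.ext eQ (Prod.ext eA eB)

theorem exists_isFrame_of_hasBlocks {P : Finset (Finset ℕ)} (hP : IsPartition P S)
    (h : HasBlocks S₁ S₂ P) :
    ∃ q, IsFrame (S₁ ∪ S₂) S q ∧ Precedes (q.2.1 ∪ S₁) (q.2.2 ∪ S₂) ∧ glue S₁ S₂ q = P := by
  obtain ⟨A, hA, B, hB, hAB, hS₁, hS₂⟩ := h
  have hne : A ≠ B := by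
    rintro rfl
    obtain ⟨x, hx, hlt⟩ := hAB
    exact (hlt x hx).false
  have hd : Disjoint A B := hP.2.1 A hA B hB hne
  have hd' := Finset.disjoint_left.1 hd
  have eA : A \ (S₁ ∪ S₂) ∪ S₁ = A := by grind
  have eB : B \ (S₁ ∪ S₂) ∪ S₂ = B := by grind
  have eU : A \ (S₁ ∪ S₂) ∪ B \ (S₁ ∪ S₂) ∪ (S₁ ∪ S₂) = A ∪ B := by grind
  have hsub : ∀ C ∈ P, C ⊆ S := fun C hC => by
    rw [← hP.2.2]
    exact Finset.subset_biUnion_of_mem id hC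
  refine ⟨((P.erase A).erase B, A \ (S₁ ∪ S₂), B \ (S₁ ∪ S₂)), ⟨?_, ?_, ?_, ?_, ?_⟩, ?_, ?_⟩
  · simp only [eU]
    refine ⟨fun h0 => hP.1 (by grind), fun C hC D hD => hP.2.1 C (by grind) D (by grind), ?_⟩
    ext x
    simp only [Finset.mem_biUnion, Finset.mem_erase, id, Finset.mem_sdiff, Finset.mem_union,
      not_or]
    constructor
    · rintro ⟨C, ⟨hCB, hCA, hC⟩, hx⟩
      exact ⟨hsub C hC hx, fun hxA => hCA (hP.eq_of_mem hC hA hx hxA),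
        fun hxB => hCB (hP.eq_of_mem hC hB hx hxB)⟩
    · rintro ⟨hx, hxA, hxB⟩
      obtain ⟨C, hC, hxC⟩ := hP.exists_mem hx
      exact ⟨C, ⟨fun e => hxB (e ▸ hxC), fun e => hxA (e ▸ hxC), hC⟩, hxC⟩
  · simp only [eU]
    exact Finset.union_subset (hsub A hA) (hsub B hB)
  · exact Finset.disjoint_of_subset_left Finset.sdiff_subset
      (Finset.disjoint_of_subset_right Finset.sdiff_subset hd)
  · exact Finset.sdiff_disjoint
  · exact Finset.sdiff_disjoint
  · simpa only [eA, eB] using hAB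
  · simp only [glue, eA, eB]
    rw [Finset.insert_erase (by simp [hB, hne.symm]), Finset.insert_erase hA]

theorem setOf_hasBlocks_eq_image (hd : Disjoint S₁ S₂) (h₁ : S₁.Nonempty) (h₂ : S₂.Nonempty)
    (p : ℕ → Prop) :
    {P | IsPartition P S ∧ p P.card ∧ HasBlocks S₁ S₂ P} =
      glue S₁ S₂ '' {q | IsFrame (S₁ ∪ S₂) S q ∧ p (q.1.card + 2) ∧
        Precedes (q.2.1 ∪ S₁) (q.2.2 ∪ S₂)} := by
  ext P
  constructor
  · rintro ⟨hP, hp, hb⟩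
    obtain ⟨q, hq, hpre, rfl⟩ := exists_isFrame_of_hasBlocks hP hb
    exact ⟨q, ⟨hq, hq.card_glue hd h₁ h₂ ▸ hp, hpre⟩, rfl⟩
  · rintro ⟨q, ⟨hq, hp, hpre⟩, rfl⟩
    refine ⟨hq.isPartition_glue hd h₁ h₂, (hq.card_glue hd h₁ h₂).symm ▸ hp, ?_⟩
    exact ⟨_, by simp [glue], _, by simp [glue], hpre, Finset.subset_union_right,
      Finset.subset_union_right⟩

end Frame

/-- Whether `A ∪ S₁` precedes `B ∪ S₂` depends, apart from `A`, `B` and `S₁ ∪ S₂`, only on which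
of `S₁`, `S₂` contains the least element of `S₁ ∪ S₂`. -/
theorem Precedes.of_union_eq {A B S₁ S₂ T₁ T₂ : Finset ℕ} {m : ℕ} (hST : S₁ ∪ S₂ = T₁ ∪ T₂)
    (hT : Disjoint T₁ T₂) (hm : ∀ x ∈ T₁ ∪ T₂, m ≤ x) (hmem : m ∈ S₁ ∧ m ∈ T₁ ∨ m ∈ S₂ ∧ m ∈ T₂)
    (h : Precedes (A ∪ S₁) (B ∪ S₂)) : Precedes (A ∪ T₁) (B ∪ T₂) := by
  obtain ⟨x, hx, hlt⟩ := h
  have hxA : x < m → x ∈ A := fun hxm =>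
    (Finset.mem_union.1 hx).resolve_right fun hxS =>
      (hm x (hST ▸ Finset.mem_union_left _ hxS)).not_gt hxm
  rcases hmem with ⟨mS, mT⟩ | ⟨mS, mT⟩
  · rcases lt_or_ge x m with hxm | hxm
    · refine ⟨x, Finset.mem_union_left _ (hxA hxm), fun y hy => ?_⟩
      rcases Finset.mem_union.1 hy with hy | hy
      · exact hlt y (Finset.mem_union_left _ hy)
      · exact hxm.trans_le (hm y (Finset.mem_union_right _ hy))
    · refine ⟨m, Finset.mem_union_right _ mT, fun y hy => ?_⟩
      rcases Finset.mem_union.1 hy with hy | hy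
      · exact hxm.trans_lt (hlt y (Finset.mem_union_left _ hy))
      · exact lt_of_le_of_ne (hm y (Finset.mem_union_right _ hy)) (by
          rintro rfl
          exact Finset.disjoint_left.1 hT mT hy)
  · have hxm := hlt m (Finset.mem_union_right _ mS)
    refine ⟨x, Finset.mem_union_left _ (hxA hxm), fun y hy => ?_⟩
    rcases Finset.mem_union.1 hy with hy | hy
    · exact hlt y (Finset.mem_union_left _ hy)
    · exact hxm.trans_le (hm y (Finset.mem_union_right _ hy))

theorem ncard_hasBlocks_eq {S₁ S₂ T₁ T₂ : Finset ℕ} {m : ℕ} (S : Finset ℕ) (p : ℕ → Prop)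
    (hST : S₁ ∪ S₂ = T₁ ∪ T₂) (hS : Disjoint S₁ S₂) (hT : Disjoint T₁ T₂)
    (hS₁ : S₁.Nonempty) (hS₂ : S₂.Nonempty) (hT₁ : T₁.Nonempty) (hT₂ : T₂.Nonempty)
    (hm : ∀ x ∈ T₁ ∪ T₂, m ≤ x) (hmem : m ∈ S₁ ∧ m ∈ T₁ ∨ m ∈ S₂ ∧ m ∈ T₂) :
    {P | IsPartition P S ∧ p P.card ∧ HasBlocks S₁ S₂ P}.ncard =
      {P | IsPartition P S ∧ p P.card ∧ HasBlocks T₁ T₂ P}.ncard := by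
  rw [setOf_hasBlocks_eq_image hS hS₁ hS₂, setOf_hasBlocks_eq_image hT hT₁ hT₂,
    ((injOn_glue hS hS₁ hS₂).mono fun q hq => hq.1).ncard_image,
    ((injOn_glue hT hT₁ hT₂).mono fun q hq => hq.1).ncard_image]
  congr 1
  ext q
  simp only [Set.mem_ofPred_eq, hST]
  refine and_congr_right fun _ => and_congr_right fun _ => ⟨?_, ?_⟩
  · exact Precedes.of_union_eq hST hT hm hmem
  · exact Precedes.of_union_eq hST.symm hS (hST ▸ hm) (hmem.imp And.symm And.symm)

theorem TwoPattern.letterSet_union {r : ℕ} {σ : Fin r → ℕ} (hσ : TwoPattern σ)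
    (i : Fin r → ℕ) : letterSet σ i 1 ∪ letterSet σ i 2 = Finset.univ.image i := by
  ext x
  simp only [Finset.mem_union, mem_letterSet, Finset.mem_image, Finset.mem_univ, true_and]
  constructor
  · rintro (⟨t, -, ht⟩ | ⟨t, -, ht⟩) <;> exact ⟨t, ht⟩
  · rintro ⟨t, ht⟩
    exact (hσ.1 t).imp (fun h => ⟨t, h, ht⟩) fun h => ⟨t, h, ht⟩

theorem disjoint_letterSet {r : ℕ} (σ : Fin r → ℕ) {i : Fin r → ℕ} (hi : Function.Injective i)
    {l l' : ℕ} (hl : l ≠ l') : Disjoint (letterSet σ i l) (letterSet σ i l') := by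
  rw [Finset.disjoint_left]
  intro x hx hx'
  obtain ⟨t, ht, rfl⟩ := mem_letterSet.1 hx
  obtain ⟨u, hu, hut⟩ := mem_letterSet.1 hx'
  exact hl (by rw [← ht, ← hu, hi hut])

theorem letterSet_nonempty {r : ℕ} {σ i : Fin r → ℕ} {l : ℕ} (h : ∃ t, σ t = l) :
    (letterSet σ i l).Nonempty :=
  h.elim fun t ht => ⟨i t, mem_letterSet.2 ⟨t, ht, rfl⟩⟩

theorem mem_partitions {n : ℕ} {P : Finset (Finset ℕ)} :
    P ∈ partitions n ↔ IsPartition P (seg n) := by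
  simp only [partitions, Finset.mem_filter, Finset.mem_powerset, and_iff_right_iff_imp]
  intro h B hB
  rw [Finset.mem_powerset, ← h.2.2]
  exact Finset.subset_biUnion_of_mem id hB

/-- The increasing sequences of length `r` in `[n]`. -/
noncomputable def increasingSeqs (n r : ℕ) : Finset (Fin r → ℕ) :=
  (Fintype.piFinset fun _ => seg n).filter StrictMono

theorem occ_eq_card_filter {n r : ℕ} {σ : Fin r → ℕ} (hσ : TwoPattern σ)
    {P : Finset (Finset ℕ)} (hP : IsPartition P (seg n)) :
    occ n σ P = ((increasingSeqs n r).filter fun i =>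
      HasBlocks (letterSet σ i 1) (letterSet σ i 2) P).card := by
  rw [occ]
  refine Nat.subtype_card _ fun i => ?_
  simp only [increasingSeqs, Finset.mem_filter, Fintype.mem_piFinset]
  constructor
  · rintro ⟨⟨hi, hmono⟩, hb⟩
    exact ⟨hmono, hi, (exists_rgf_iff_hasBlocks hσ hP hi).2 hb⟩
  · rintro ⟨hmono, hi, h⟩
    exact ⟨⟨hi, hmono⟩, (exists_rgf_iff_hasBlocks hσ hP hi).1 h⟩

theorem sum_occ_eq {n r : ℕ} {σ : Fin r → ℕ} (hσ : TwoPattern σ) {p : ℕ → Prop}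
    {F : Finset (Finset (Finset ℕ))} (hF : ∀ P, P ∈ F ↔ IsPartition P (seg n) ∧ p P.card) :
    ∑ P ∈ F, occ n σ P =
      ∑ i ∈ increasingSeqs n r, {P | IsPartition P (seg n) ∧ p P.card ∧
        HasBlocks (letterSet σ i 1) (letterSet σ i 2) P}.ncard := by
  rw [Finset.sum_congr rfl fun P hP =>
    occ_eq_card_filter hσ ((hF P).1 hP).1]
  simp only [Finset.card_filter]
  rw [Finset.sum_comm]
  refine Finset.sum_congr rfl fun i _ => ?_
  rw [← Finset.card_filter, ← Set.ncard_coe_finset]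
  congr 1
  ext P
  simp [hF, and_assoc]

theorem sum_occ_eq_of_first_eq {r : ℕ} (hr : 0 < r) {σ τ : Fin r → ℕ} (hσ : TwoPattern σ)
    (hτ : TwoPattern τ) (hfirst : σ ⟨0, hr⟩ = τ ⟨0, hr⟩) {n : ℕ} {p : ℕ → Prop}
    {F : Finset (Finset (Finset ℕ))} (hF : ∀ P, P ∈ F ↔ IsPartition P (seg n) ∧ p P.card) :
    ∑ P ∈ F, occ n σ P = ∑ P ∈ F, occ n τ P := by
  rw [sum_occ_eq hσ hF, sum_occ_eq hτ hF]
  refine Finset.sum_congr rfl fun i hi => ?_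
  have hmono : StrictMono i := (Finset.mem_filter.1 hi).2
  refine ncard_hasBlocks_eq (m := i ⟨0, hr⟩) _ p
    ((hσ.letterSet_union i).trans (hτ.letterSet_union i).symm)
    (disjoint_letterSet σ hmono.injective (by decide))
    (disjoint_letterSet τ hmono.injective (by decide))
    (letterSet_nonempty hσ.2.1) (letterSet_nonempty hσ.2.2)
    (letterSet_nonempty hτ.2.1) (letterSet_nonempty hτ.2.2) ?_ ?_
  · rw [hτ.letterSet_union]
    intro x hx
    obtain ⟨t, -, rfl⟩ := Finset.mem_image.1 hx
    exact hmono.monotone (Fin.mk_le_of_le_val (Nat.zero_le _))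
  · simp only [mem_letterSet]
    exact (hσ.1 ⟨0, hr⟩).imp (fun h => ⟨⟨_, h, rfl⟩, _, hfirst ▸ h, rfl⟩)
      fun h => ⟨⟨_, h, rfl⟩, _, hfirst ▸ h, rfl⟩

/-- the number of occurrences of a 2-pattern only depends on its first letter. -/
theorem occ_depends_only_on_first_letter {r : ℕ} (hr : 0 < r) (σ τ : Fin r → ℕ)
    (hσ : TwoPattern σ) (hτ : TwoPattern τ) (hfirst : σ ⟨0, hr⟩ = τ ⟨0, hr⟩)
    (n k : ℕ) (hn : 1 ≤ n) (hk : 1 ≤ k) :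
    (∑ π ∈ partitionsK n k, occ n σ π) = (∑ π ∈ partitionsK n k, occ n τ π) ∧
    (∑ π ∈ partitions n, occ n σ π) = (∑ π ∈ partitions n, occ n τ π) := by
  refine ⟨?_, ?_⟩
  · exact sum_occ_eq_of_first_eq hr hσ hτ hfirst (p := (· = k)) fun P => by
      simp [partitionsK, mem_partitions]
  · exact sum_occ_eq_of_first_eq hr hσ hτ hfirst (p := fun _ => True) fun P => by
      simp [mem_partitions]
end
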